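/- If G is a finite simple group with U(G) = {1, rq, 8pq, 4qr, 8pr} for primes p, q, r, then p, q, r are distinct odd primes. -/

import Mathlib

open scoped MatrixGroups

/-- The size of the conjugacy class of `x`. -/
noncomputable def classSize {G : Type*} [Group G] (x : G) : ℕ :=
  Nat.card {y : G // IsConj x y}

/-- `u_G(n)`: the number of elements of `G` whose conjugacy class has size `n`. -/
noncomputable def sameSizeCount (G : Type*) [Group G] (n : ℕ) : ℕ :=
  Nat.card {x : G // classSize x = n}

/-- `U(G)`: the same-size conjugacy class set of `G`. -/
def sameSizeSet (G : Type*) [Group G] : Set ℕ :=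
  {m | ∃ x : G, m = sameSizeCount G (classSize x)}

open Polynomial in
lemma bur_scalar {d m : ℕ} (hm : m ≠ 0) (M : Matrix (Fin d) (Fin d) ℂ) (hM : M ^ m = 1) (c : ℂ)
    (hc : c ^ m = 1) (h : ∀ z ∈ M.charpoly.roots, z = c) : M = algebraMap ℂ _ c := by
  have h1 : M.charpoly = (X - C c) ^ d := by
    have hs := (IsAlgClosed.splits M.charpoly).eq_prod_roots_of_monic M.charpoly_monic
    have hr : M.charpoly.roots = Multiset.replicate d c := by
      rw [Multiset.eq_replicate]
      refine ⟨?_, h⟩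
      rw [← (IsAlgClosed.splits M.charpoly).natDegree_eq_card_roots, M.charpoly_natDegree_eq_dim]
      simp
    rw [hs, hr]; simp
  have h2 : (X - C c) ∣ (X ^ m - 1 : ℂ[X]) := by
    rw [dvd_iff_isRoot]; simp [hc]
  obtain ⟨g, hg⟩ := h2
  have hsep : (X ^ m - 1 : ℂ[X]).Separable := by
    have := separable_X_pow_sub_C (1 : ℂ) (n := m) (by exact_mod_cast hm) one_ne_zero
    simpa using this
  have hco : IsCoprime (X - C c) g := by
    rw [hg] at hsep; exact hsep.isCoprime
  obtain ⟨a, b, hab⟩ := (hco.pow_left : IsCoprime ((X - C c) ^ d) g)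
  have h3 : X - C c = a * (X - C c) * M.charpoly + b * (X ^ m - 1) := by
    rw [h1, hg]; linear_combination (-(X - C c)) * hab
  have h4 := congrArg (aeval M) h3
  simp [Matrix.aeval_self_charpoly, hM] at h4
  exact sub_eq_zero.mp h4

lemma bur_avg {m d : ℕ} (hm : m ≠ 0) (hd : d ≠ 0) (s : Multiset ℂ) (hs : s.card = d)
    (h1 : ∀ z ∈ s, z ^ m = 1) (hint : IsIntegral ℤ (s.sum / d)) :
    s.sum = 0 ∨ ∃ c, c ^ m = 1 ∧ ∀ z ∈ s, z = c := by
  classical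
  have : NeZero m := ⟨hm⟩
  have : NeZero ((m : ℕ) : ℚ) := ⟨by exact_mod_cast hm⟩
  have hd0 : (0:ℝ) < d := by exact_mod_cast Nat.pos_of_ne_zero hd
  have hdC : (d:ℂ) ≠ 0 := by exact_mod_cast hd
  obtain ⟨L, _, _, ζ, hζ⟩ : ∃ (L : Type) (_ : Field L) (_ : NumberField L) (ζ : L),
      IsPrimitiveRoot ζ m := by
    obtain ⟨ζ, hζ⟩ := (CyclotomicField.isCyclotomicExtension m ℚ).exists_isPrimitiveRoot
      (Set.mem_singleton m) hm
    exact ⟨CyclotomicField m ℚ, inferInstance, inferInstance, ζ, hζ⟩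
  let φ : L →ₐ[ℚ] ℂ := IsAlgClosed.lift
  have hφ : IsPrimitiveRoot (φ ζ) m := hζ.map_of_injective φ.toRingHom.injective
  have hex : ∀ z : ℂ, ∃ w : L, z ^ m = 1 → φ w = z ∧ w ^ m = 1 := by
    intro z
    by_cases hz : z ^ m = 1
    · obtain ⟨i, -, hi⟩ := hφ.eq_pow_of_pow_eq_one hz
      refine ⟨ζ ^ i, fun _ => ⟨by simpa using hi, ?_⟩⟩
      rw [← pow_mul, mul_comm, pow_mul, hζ.pow_eq_one, one_pow]
    · exact ⟨0, fun h => absurd h hz⟩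
  choose w hw using hex
  have norm_sum : ∀ t : Multiset ℂ, (∀ z ∈ t, z ^ m = 1) → ‖t.sum‖ ≤ t.card := by
    intro t
    induction t using Multiset.induction with
    | empty => simp
    | cons a t ih =>
      intro h
      have := ih (fun z hz => h z (by simp [hz]))
      have ha : ‖a‖ = 1 := Complex.norm_eq_one_of_pow_eq_one (h a (by simp)) hm
      simp only [Multiset.sum_cons, Multiset.card_cons, Nat.cast_add, Nat.cast_one]
      linarith [norm_add_le a t.sum]
  let α : L := (s.map w).sum / d
  have hα : φ α = s.sum / d := by
    simp only [α, map_div₀, map_multiset_sum, map_natCast, Multiset.map_map]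
    congr 2
    conv_rhs => rw [← Multiset.map_id s]
    exact Multiset.map_congr rfl (fun z hz => (hw z (h1 z hz)).1)
  have hαint : IsIntegral ℤ α := by
    rw [← hα] at hint
    exact (isIntegral_algHom_iff (φ.restrictScalars ℤ) φ.toRingHom.injective).mp hint
  have hσ : ∀ σ : L →ₐ[ℚ] ℂ, ‖σ α‖ ≤ 1 := by
    intro σ
    have : σ α = (s.map (fun z => σ (w z))).sum / d := by
      simp [α, map_div₀, map_multiset_sum, Multiset.map_map]
    rw [this, norm_div, div_le_one (by simpa using hd0)]
    have h2 := norm_sum (s.map (fun z => σ (w z))) (by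
      intro z hz
      obtain ⟨y, hy, rfl⟩ := Multiset.mem_map.mp hz
      rw [← map_pow, (hw y (h1 y hy)).2, map_one])
    simpa [hs] using h2
  by_cases hlt : ‖s.sum / d‖ < 1
  · left
    have hn := Algebra.norm_eq_prod_embeddings ℚ ℂ α
    have hni : IsIntegral ℤ (Algebra.norm ℚ α) := Algebra.isIntegral_norm ℚ hαint
    obtain ⟨k, hk⟩ := IsIntegrallyClosed.isIntegral_iff.mp hni
    have hlt2 : ‖(algebraMap ℚ ℂ) (Algebra.norm ℚ α)‖ < 1 := by
      rw [hn, norm_prod, ← Finset.mul_prod_erase _ _ (Finset.mem_univ φ)]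
      have : ∏ σ ∈ Finset.univ.erase φ, ‖σ α‖ ≤ 1 :=
        Finset.prod_le_one (fun _ _ => norm_nonneg _) (fun σ _ => hσ σ)
      rw [hα]
      have h0 := norm_nonneg (s.sum / (d:ℂ))
      nlinarith [norm_nonneg (s.sum / (d:ℂ))]
    rw [← hk] at hlt2
    have hk0 : k = 0 := by
      have : ‖(k : ℂ)‖ < 1 := by simpa using hlt2
      rw [Complex.norm_intCast] at this
      have h3 : |k| < 1 := by exact_mod_cast this
      exact Int.abs_lt_one_iff.mp h3
    rw [hk0] at hk
    have : Algebra.norm ℚ α = 0 := by rw [← hk]; simp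
    rw [Algebra.norm_eq_zero_iff] at this
    rw [this, map_zero] at hα
    rcases div_eq_zero_iff.mp hα.symm with h | h
    · exact h
    · exact absurd h hdC
  · right
    set c := s.sum / d with hcdef
    have hc1 : ‖c‖ = 1 := by
      apply le_antisymm _ (not_lt.mp hlt)
      rw [← hα]; exact hσ φ
    have hsum : s.sum = d * c := by rw [hcdef]; field_simp
    have hz1 : ∀ z ∈ s, ‖z‖ = 1 := fun z hz => Complex.norm_eq_one_of_pow_eq_one (h1 z hz) hm
    have key : ∀ t : Multiset ℂ, (∀ z ∈ t, ‖z‖ = 1) →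
        (starRingEnd ℂ c * t.sum).re ≤ t.card ∧
        ((starRingEnd ℂ c * t.sum).re = t.card → ∀ z ∈ t, z = c) := by
      intro t
      induction t using Multiset.induction with
      | empty => simp
      | cons a t ih =>
        intro h
        obtain ⟨i1, i2⟩ := ih (fun z hz => h z (by simp [hz]))
        have ha := h a (by simp)
        have hn : ‖starRingEnd ℂ c * a‖ = 1 := by rw [norm_mul, ha, RCLike.norm_conj, hc1, one_mul]
        have hre := Complex.re_le_norm (starRingEnd ℂ c * a)
        rw [hn] at hre
        simp only [Multiset.sum_cons, Multiset.card_cons, Nat.cast_add, Nat.cast_one, mul_add,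
          Complex.add_re]
        refine ⟨by linarith, fun he => ?_⟩
        have e1 : (starRingEnd ℂ c * a).re = 1 := by linarith
        have e2 := i2 (by linarith)
        have e3 : starRingEnd ℂ c * a = 1 := by
          have hh := Complex.sq_norm (starRingEnd ℂ c * a)
          rw [hn, Complex.normSq_apply, e1] at hh
          apply Complex.ext
          · simpa using e1
          · have : (starRingEnd ℂ c * a).im * (starRingEnd ℂ c * a).im = 0 := by linarith
            simpa using this
        intro z hz
        rcases Multiset.mem_cons.mp hz with rfl | hz
        · have e4 : c * starRingEnd ℂ c = 1 := by
            rw [Complex.mul_conj, Complex.normSq_eq_norm_sq, hc1]; simp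
          calc z = (c * starRingEnd ℂ c) * z := by rw [e4, one_mul]
            _ = c * (starRingEnd ℂ c * z) := by ring
            _ = c := by rw [e3, mul_one]
        · exact e2 z hz
    have hall := (key s hz1).2 (by
      rw [hsum, hs]
      have : starRingEnd ℂ c * (d * c) = ((d:ℝ):ℂ) := by
        have e4 : starRingEnd ℂ c * c = 1 := by
          rw [mul_comm, Complex.mul_conj, Complex.normSq_eq_norm_sq, hc1]; simp
        calc _ = (d:ℂ) * (starRingEnd ℂ c * c) := by ring
          _ = _ := by rw [e4]; simp
      rw [this]; simp)
    have : ∃ z, z ∈ s := Multiset.card_pos_iff_exists_mem.mp (by omega)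
    obtain ⟨z, hz⟩ := this
    exact ⟨c, by rw [← hall z hz]; exact h1 z hz, hall⟩

lemma bur_trace {n : ℕ} (d : Fin n → ℕ) (a : Π i, Matrix (Fin (d i)) (Fin (d i)) ℂ) :
    LinearMap.trace ℂ _ (LinearMap.mulLeft ℂ a) = ∑ i, (d i : ℂ) * (a i).trace := by
  classical
  rw [LinearMap.trace_eq_matrix_trace ℂ
    (Pi.basis (fun i => Matrix.stdBasis ℂ (Fin (d i)) (Fin (d i))))]
  simp only [Matrix.trace, Matrix.diag, LinearMap.toMatrix_apply, Fintype.sum_sigma,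
    Fintype.sum_prod_type, Pi.basis_repr, LinearMap.mulLeft_apply, Pi.basis_apply]
  refine Finset.sum_congr rfl fun i _ => ?_
  rw [Finset.mul_sum]
  refine Finset.sum_congr rfl fun p _ => ?_
  simp only [Matrix.stdBasis_eq_single]
  simp [Matrix.stdBasis, Matrix.mul_apply, Matrix.single_apply]

lemma bur_trace_group {G : Type*} [Group G] [Finite G] (g : G) (hg : g ≠ 1) :
    LinearMap.trace ℂ _ (LinearMap.mulLeft ℂ (MonoidAlgebra.of ℂ G g)) = 0 := by
  classical
  have := Fintype.ofFinite G
  let b : Module.Basis G ℂ (MonoidAlgebra ℂ G) := MonoidAlgebra.basis G ℂ 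
  rw [LinearMap.trace_eq_matrix_trace ℂ b]
  refine Finset.sum_eq_zero fun x _ => ?_
  simp only [Matrix.diag, LinearMap.toMatrix_apply]
  simp [b, hg, MonoidAlgebra.basis, MonoidAlgebra.single_mul_single]

lemma center_bot {G : Type*} [Group G] [IsSimpleGroup G]
    (hna : ¬ ∀ a b : G, a * b = b * a) : Subgroup.center G = ⊥ := by
  rcases (inferInstance : (Subgroup.center G).Normal).eq_bot_or_eq_top with h | h
  · exact h
  · exfalso; apply hna
    intro a b
    have : b ∈ Subgroup.center G := by rw [h]; trivial
    exact (Subgroup.mem_center_iff.mp this a)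

lemma bur_central {A : Type*} [Ring A] [Algebra ℂ A] {n : ℕ} (d : Fin n → ℕ)
    (e : A ≃ₐ[ℂ] Π i, Matrix (Fin (d i)) (Fin (d i)) ℂ) (k : A) (hk : ∀ a, a * k = k * a)
    (i : Fin n) : ∃ c : ℂ, e k i = algebraMap ℂ _ c := by
  classical
  have : e k i ∈ Set.range (Matrix.scalar (Fin (d i)) : ℂ →+* _) := by
    rw [Matrix.mem_range_scalar_iff_commute_single]
    intro p q _
    have h := congrArg (fun z => e z i) (hk (e.symm (Pi.single i (Matrix.single p q 1))))
    have h2 : Matrix.single p q 1 * e k i = e k i * Matrix.single p q 1 := by simpa using h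
    exact h2
  obtain ⟨c, hc⟩ := this
  exact ⟨c, hc.symm⟩

lemma MonoidAlgebra_central {G : Type*} [Group G] (k : MonoidAlgebra ℂ G)
    (h : ∀ g : G, MonoidAlgebra.of ℂ G g * k = k * MonoidAlgebra.of ℂ G g) :
    ∀ a, a * k = k * a := by
  intro a
  induction a using MonoidAlgebra.induction_on with
  | of g => exact h g
  | add a b ha hb => rw [add_mul, mul_add, ha, hb]
  | smul c a ha => rw [smul_mul_assoc, mul_smul_comm, ha]

theorem burnside_class {G : Type*} [Group G] [Finite G] [IsSimpleGroup G]
    (hna : ¬ ∀ a b : G, a * b = b * a) (x : G) (hx : x ≠ 1) (t : ℕ) (ht : t.Prime) (a : ℕ)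
    (hcl : classSize x = t ^ a) : False := by
  classical
  have := Fintype.ofFinite G
  obtain ⟨n, d, hd, ⟨e⟩⟩ :=
    IsSemisimpleRing.exists_algEquiv_pi_matrix_of_isAlgClosed ℂ (MonoidAlgebra ℂ G)
  let ρ : ∀ i, G →* Matrix (Fin (d i)) (Fin (d i)) ℂ := fun i =>
    { toFun := fun g => e (MonoidAlgebra.of ℂ G g) i
      map_one' := by simp only [map_one]; rfl
      map_mul' := fun g h => by simp only [map_mul]; rfl }
  have hρ : ∀ i g, ρ i g = e (MonoidAlgebra.of ℂ G g) i := fun i g => rfl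
  -- trace identity
  have htr : ∑ i, (d i : ℂ) * (ρ i x).trace = 0 := by
    rw [← bur_trace_group x hx, ← LinearMap.trace_conj' _ e.toLinearEquiv]
    have := bur_trace d (e (MonoidAlgebra.of ℂ G x))
    simp only [hρ]
    rw [← this]
    congr 1
    apply LinearMap.ext
    intro v
    simp [LinearEquiv.conj_apply]
  -- scalar implies trivial
  have hscal : ∀ i c, ρ i x = algebraMap ℂ _ c → ∀ g, ρ i g = 1 := by
    intro i c hc
    rcases (inferInstance : (ρ i).ker.Normal).eq_bot_or_eq_top with h | h
    · exfalso
      have hinj := (MonoidHom.ker_eq_bot_iff _).mp h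
      have : x ∈ Subgroup.center G := by
        rw [Subgroup.mem_center_iff]
        intro g
        apply hinj
        rw [map_mul, map_mul, hc]
        exact (Algebra.commutes c _).symm
      rw [center_bot hna] at this
      exact hx (by simpa using this)
    · intro g
      have : g ∈ (ρ i).ker := by rw [h]; trivial
      exact this
  -- trivial components
  have htriv : ∀ i, (∀ g, ρ i g = 1) → ∀ y, e y i = (MonoidAlgebra.lift ℂ ℂ G 1 y) • 1 := by
    intro i hi y
    induction y using MonoidAlgebra.induction_on with
    | of g => rw [← hρ, hi]; simp
    | add a b ha hb => rw [map_add, Pi.add_apply, ha, hb, map_add, add_smul]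
    | smul c a ha => rw [map_smul, Pi.smul_apply, ha, map_smul, smul_assoc]
  have hone : ∀ i, (∀ g, ρ i g = 1) → d i = 1 := by
    intro i hi
    have hsub : Subsingleton (Fin (d i)) := by
      constructor
      intro p q
      by_contra hpq
      have h := htriv i hi (e.symm (Pi.single i (Matrix.single p p 1)))
      simp only [AlgEquiv.apply_symm_apply, Pi.single_eq_same] at h
      have h1 := congrFun (congrFun h p) p
      have h2 := congrFun (congrFun h q) q
      simp [hpq] at h1 h2
      rw [← h1] at h2
      exact one_ne_zero h2.symm
    have h3 := Fintype.card_le_one_iff_subsingleton.mpr hsub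
    rw [Fintype.card_fin] at h3
    have := (hd i).out
    omega
  have huniq : ∀ i j, (∀ g, ρ i g = 1) → (∀ g, ρ j g = 1) → i = j := by
    intro i j hi hj
    by_contra hij
    have h1 := htriv i hi (e.symm (Pi.single i 1))
    have h2 := htriv j hj (e.symm (Pi.single i 1))
    rw [AlgEquiv.apply_symm_apply] at h1 h2
    have hdi := hd i
    have hdj := hd j
    rw [Pi.single_eq_same] at h1
    rw [Pi.single_eq_of_ne (Ne.symm hij)] at h2
    have h3 := congrFun (congrFun h1 0) 0
    have h4 := congrFun (congrFun h2 0) 0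
    simp at h3 h4
    rw [← h3] at h4
    exact one_ne_zero h4.symm
  obtain ⟨i0, hi0⟩ : ∃ i, ∀ g, ρ i g = 1 := by
    by_contra hno
    push Not at hno
    let s : MonoidAlgebra ℂ G := ∑ g, MonoidAlgebra.of ℂ G g
    have hl : ∀ g, MonoidAlgebra.of ℂ G g * s = s := by
      intro g
      simp only [s, Finset.mul_sum, ← map_mul]
      exact Fintype.sum_equiv (Equiv.mulLeft g) _ _ (fun _ => rfl)
    have hr : ∀ g, s * MonoidAlgebra.of ℂ G g = s := by
      intro g
      simp only [s, Finset.sum_mul, ← map_mul]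
      exact Fintype.sum_equiv (Equiv.mulRight g) _ _ (fun _ => rfl)
    have hc := MonoidAlgebra_central s (fun g => by rw [hl, hr])
    have : e s = 0 := by
      funext i
      obtain ⟨c, hc⟩ := bur_central d e s hc i
      obtain ⟨g, hg⟩ := hno i
      have h1 : ρ i g * e s i = e s i := by
        rw [hρ, ← Pi.mul_apply, ← map_mul, hl]
      rw [hc, Algebra.algebraMap_eq_smul_one, mul_smul_comm, mul_one] at h1
      rw [hc, Algebra.algebraMap_eq_smul_one]
      by_cases h0 : c = 0
      · simp [h0]
      · exact absurd (smul_right_injective _ h0 h1) hg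
    have hs0 : s = 0 := by simpa using this
    have h2 := congrArg (MonoidAlgebra.lift ℂ ℂ G 1) hs0
    simp [s] at h2
  -- integrality
  have hint : ∀ i, IsIntegral ℤ (ρ i x).trace ∧ ((ρ i x).trace = 0 ∨ t ∣ d i ∨ i = i0) := by
    intro i
    set m := orderOf x with hm
    have hm0 : m ≠ 0 := (orderOf_pos x).ne'
    have hpow : (ρ i x) ^ m = 1 := by rw [← map_pow, pow_orderOf_eq_one, map_one]
    have hroots : ∀ z ∈ (ρ i x).charpoly.roots, z ^ m = 1 := by
      intro z hz
      have hz := Polynomial.isRoot_of_mem_roots hz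
      rw [← Matrix.mem_spectrum_iff_isRoot_charpoly] at hz
      have h1 := spectrum.pow_mem_pow (ρ i x) m hz
      rw [hpow] at h1
      have hdi := hd i
      simpa using h1
    have htrs := Matrix.trace_eq_sum_roots_charpoly (ρ i x)
    have hcard : (ρ i x).charpoly.roots.card = d i := by
      rw [← (IsAlgClosed.splits _).natDegree_eq_card_roots, Matrix.charpoly_natDegree_eq_dim]
      simp
    have hI : IsIntegral ℤ (ρ i x).trace := by
      rw [htrs]
      apply IsIntegral.multiset_sum
      intro z hz
      exact IsIntegral.of_pow (Nat.pos_of_ne_zero hm0) (by rw [hroots z hz]; exact isIntegral_one)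
    refine ⟨hI, ?_⟩
    by_cases htd : t ∣ d i
    · exact Or.inr (Or.inl htd)
    -- class sum
    let K : Finset G := Finset.univ.filter (fun y => IsConj x y)
    have hK : K.card = t ^ a := by
      rw [← hcl, classSize, Nat.card_eq_fintype_card, Fintype.card_subtype]
    let kZ : MonoidAlgebra ℤ G := ∑ y ∈ K, MonoidAlgebra.of ℤ G y
    let k : MonoidAlgebra ℂ G := ∑ y ∈ K, MonoidAlgebra.of ℂ G y
    have hk : ∀ a, a * k = k * a := by
      apply MonoidAlgebra_central
      intro g
      simp only [k, Finset.mul_sum, Finset.sum_mul, ← map_mul]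
      refine Finset.sum_bij' (fun y _ => g * y * g⁻¹) (fun y _ => g⁻¹ * y * g) ?_ ?_ ?_ ?_ ?_
      · intro y hy
        simp only [K, Finset.mem_filter, Finset.mem_univ, true_and] at hy ⊢
        exact hy.trans (isConj_iff.mpr ⟨g, rfl⟩)
      · intro y hy
        simp only [K, Finset.mem_filter, Finset.mem_univ, true_and] at hy ⊢
        exact hy.trans (isConj_iff.mpr ⟨g⁻¹, by simp⟩)
      · intro y _; group
      · intro y _; group
      · intro y _; congr 1; group
    obtain ⟨ω, hω⟩ := bur_central d e k hk i
    have hdi := hd i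
    have hdC : (d i : ℂ) ≠ 0 := by exact_mod_cast hdi.out
    have hωint : IsIntegral ℤ ω := by
      have h1 : IsIntegral ℤ kZ := IsIntegral.of_finite ℤ kZ
      let f : MonoidAlgebra ℤ G →ₐ[ℤ] Matrix (Fin (d i)) (Fin (d i)) ℂ :=
        MonoidAlgebra.lift ℤ _ G (ρ i)
      have h2 : f kZ = algebraMap ℂ _ ω := by
        rw [← hω]
        simp [f, kZ, k, hρ]
      have h3 := h1.map f
      rw [h2] at h3
      exact (isIntegral_algebraMap_iff (FaithfulSMul.algebraMap_injective ℂ _)).mp h3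
    have hωtr : (t ^ a : ℕ) * (ρ i x).trace = d i * ω := by
      have h1 : (e k i).trace = d i * ω := by
        rw [hω, Algebra.algebraMap_eq_smul_one, Matrix.trace_smul, Matrix.trace_one]
        simp [mul_comm]
      rw [← h1, ← hK]
      have h2 : e k i = ∑ y ∈ K, ρ i y := by simp [k, hρ]
      rw [h2, Matrix.trace_sum, Finset.sum_congr rfl (g := fun _ => (ρ i x).trace)]
      · simp
      · intro y hy
        simp only [K, Finset.mem_filter, Finset.mem_univ, true_and] at hy
        obtain ⟨c, hc⟩ := isConj_iff.mp hy
        rw [← hc, map_mul, Matrix.trace_mul_comm, ← map_mul]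
        simp
    have hcop : IsCoprime ((t ^ a : ℕ) : ℤ) (d i : ℤ) := by
      rw [Nat.isCoprime_iff_coprime]
      exact Nat.Coprime.pow_left _ ((Nat.Prime.coprime_iff_not_dvd ht).mpr htd)
    obtain ⟨u, v, huv⟩ := hcop
    have hav : IsIntegral ℤ ((ρ i x).charpoly.roots.sum / d i) := by
      rw [← htrs]
      have : (ρ i x).trace / d i = u * ω + v * (ρ i x).trace := by
        have huv' : (u:ℂ) * ((t ^ a : ℕ) : ℂ) + v * d i = 1 := by exact_mod_cast huv
        field_simp
        linear_combination (-(ρ i x).trace) * huv' + u * hωtr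
      rw [this]
      exact ((isIntegral_algebraMap (R := ℤ) (x := u)).mul hωint).add
        ((isIntegral_algebraMap (R := ℤ) (x := v)).mul hI)
    rcases bur_avg hm0 hdi.out _ hcard hroots hav with h | ⟨c, hc, hall⟩
    · left; rw [htrs, h]
    · right; right
      exact huniq i i0 (hscal i c (bur_scalar hm0 _ hpow c hc hall)) hi0
  rw [← Finset.add_sum_erase _ _ (Finset.mem_univ i0), hi0] at htr
  have hβ : ∃ β : ℂ, IsIntegral ℤ β ∧
      ∑ i ∈ Finset.univ.erase i0, (d i : ℂ) * (ρ i x).trace = t * β := by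
    have : ∀ i ∈ Finset.univ.erase i0, ∃ β : ℂ, IsIntegral ℤ β ∧ (d i : ℂ) * (ρ i x).trace = t * β := by
      intro i hi
      obtain ⟨h1, h2 | ⟨l, hl⟩ | h2⟩ := hint i
      · exact ⟨0, isIntegral_zero, by simp [h2]⟩
      · have : IsIntegral ℤ (l : ℂ) := by
          have := (isIntegral_algebraMap (R := ℤ) (A := ℂ) (x := (l : ℤ)))
          simpa using this
        refine ⟨l * (ρ i x).trace, ?_, ?_⟩
        · exact this.mul h1
        · have h3 : (d i : ℂ) = t * l := by exact_mod_cast hl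
          linear_combination (ρ i x).trace * h3
      · exact absurd h2 (Finset.ne_of_mem_erase hi)
    choose! β hβ using this
    refine ⟨∑ i ∈ Finset.univ.erase i0, β i, IsIntegral.sum _ (fun i hi => (hβ i hi).1), ?_⟩
    rw [Finset.mul_sum]
    exact Finset.sum_congr rfl (fun i hi => (hβ i hi).2)
  obtain ⟨β, hβ, hs⟩ := hβ
  rw [hs, Matrix.trace_one, Fintype.card_fin, hone i0 hi0] at htr
  have htC : (t : ℚ) ≠ 0 := by exact_mod_cast ht.ne_zero
  have hβ2 : β = algebraMap ℚ ℂ (-1 / t) := by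
    have : (t : ℂ) ≠ 0 := by exact_mod_cast ht.ne_zero
    simp
    field_simp
    push_cast at htr
    linear_combination htr
  rw [hβ2, isIntegral_algebraMap_iff (algebraMap ℚ ℂ).injective] at hβ
  obtain ⟨z, hz⟩ := IsIntegrallyClosed.isIntegral_iff.mp hβ
  have h5 : (z : ℚ) * t = -1 := by
    have : (z:ℚ) = -1 / t := by simpa using hz
    rw [this]; field_simp
  have h6 : z * (t : ℤ) = -1 := by exact_mod_cast h5
  have h7 : (t : ℤ) ∣ 1 := ⟨-z, by linarith⟩
  have h8 : t ∣ 1 := by exact_mod_cast h7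
  exact ht.one_lt.ne' (Nat.dvd_one.mp h8)

lemma classSize_eq_index {G : Type*} [Group G] [Finite G] (x : G) :
    classSize x = (Subgroup.centralizer {x}).index := by
  have h1 := MulAction.index_stabilizer (ConjAct G) x
  rw [ConjAct.stabilizer_eq_centralizer] at h1
  have h2 : (Subgroup.centralizer {ConjAct.toConjAct x} : Subgroup (ConjAct G)).index
      = (Subgroup.centralizer {x} : Subgroup G).index := rfl
  have h3 : classSize x = (MulAction.orbit (ConjAct G) x).ncard := by
    rw [classSize, ← Nat.card_coe_set_eq]
    exact Nat.card_congr (Equiv.subtypeEquivRight fun z => by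
      rw [ConjAct.mem_orbit_conjAct]; exact isConj_comm)
  rw [h3, ← h2, ← h1]

lemma classSize_dvd_card {G : Type*} [Group G] [Finite G] (x : G) :
    classSize x ∣ Nat.card G := by
  rw [classSize_eq_index]; exact Subgroup.index_dvd_card _

lemma classSize_conj {G : Type*} [Group G] {x y : G} (h : IsConj x y) :
    classSize x = classSize y := by
  unfold classSize
  exact Nat.card_congr (Equiv.subtypeEquivRight fun z => ⟨fun hz => h.symm.trans hz, fun hz => h.trans hz⟩)

lemma classSize_dvd_count {G : Type*} [Group G] [Finite G] (x : G) :
    classSize x ∣ sameSizeCount G (classSize x) := by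
  classical
  have := Fintype.ofFinite G
  set n := classSize x with hn
  rw [sameSizeCount, Nat.card_eq_fintype_card, Fintype.card_subtype]
  rw [Finset.card_eq_sum_card_image ConjClasses.mk]
  apply Finset.dvd_sum
  intro c hc
  obtain ⟨y, hy, rfl⟩ := Finset.mem_image.mp hc
  simp only [Finset.mem_filter, Finset.mem_univ, true_and] at hy
  rw [Finset.filter_filter]
  have hc1 : classSize y = (Finset.univ.filter (fun z => IsConj y z)).card := by
    rw [classSize, Nat.card_eq_fintype_card, Fintype.card_subtype]
  apply dvd_of_eq
  refine (hy.symm.trans hc1).trans ?_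
  congr 1
  ext z
  simp only [Finset.mem_filter, Finset.mem_univ, true_and, ConjClasses.mk_eq_mk_iff_isConj]
  constructor
  · intro h; exact ⟨(classSize_conj h.symm).trans hy, h.symm⟩
  · intro h; exact h.2.symm

lemma classSize_one_iff {G : Type*} [Group G] [Finite G] [IsSimpleGroup G]
    (hna : ¬ ∀ a b : G, a * b = b * a) (x : G) : classSize x = 1 ↔ x = 1 := by
  rw [classSize_eq_index, Subgroup.index_eq_one, Subgroup.centralizer_eq_top_iff_subset,
    center_bot hna]
  simp

lemma count_one {G : Type*} [Group G] [Finite G] [IsSimpleGroup G]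
    (hna : ¬ ∀ a b : G, a * b = b * a) : sameSizeCount G 1 = 1 := by
  rw [sameSizeCount, Nat.card_eq_one_iff_unique]
  refine ⟨⟨fun a b => Subtype.ext ?_⟩, ⟨⟨1, (classSize_one_iff hna 1).mpr rfl⟩⟩⟩
  rw [(classSize_one_iff hna _).mp a.2, (classSize_one_iff hna _).mp b.2]

lemma card_eq_sum {G : Type*} [Group G] [Finite G] : ∃ S : Finset ℕ,
    (∀ n, n ∈ S ↔ ∃ x : G, classSize x = n) ∧ Nat.card G = ∑ n ∈ S, sameSizeCount G n := by
  classical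
  have := Fintype.ofFinite G
  refine ⟨Finset.univ.image (classSize : G → ℕ), by simp, ?_⟩
  rw [Nat.card_eq_fintype_card, ← Finset.card_univ, Finset.card_eq_sum_card_image (classSize : G → ℕ)]
  refine Finset.sum_congr rfl fun n _ => ?_
  rw [sameSizeCount, Nat.card_eq_fintype_card, Fintype.card_subtype]

lemma coprime_of_dvd {G : Type*} [Group G] [Finite G] [IsSimpleGroup G]
    (hna : ¬ ∀ a b : G, a * b = b * a) (d : ℕ)
    (h : ∀ x : G, sameSizeCount G (classSize x) = 1 ∨ d ∣ sameSizeCount G (classSize x)) :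
    d.Coprime (Nat.card G) := by
  classical
  obtain ⟨S, hS, hN⟩ := card_eq_sum (G := G)
  have h1 : 1 ∈ S := (hS 1).mpr ⟨1, (classSize_one_iff hna 1).mpr rfl⟩
  rw [← Finset.add_sum_erase _ _ h1, count_one hna] at hN
  have h2 : d ∣ ∑ n ∈ S.erase 1, sameSizeCount G n := by
    apply Finset.dvd_sum
    intro n hn
    obtain ⟨hn1, hnS⟩ := Finset.mem_erase.mp hn
    obtain ⟨x, rfl⟩ := (hS n).mp hnS
    rcases h x with h | h
    · exfalso
      have h3 := classSize_dvd_count x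
      rw [h] at h3
      exact hn1 (Nat.dvd_one.mp h3)
    · exact h
  obtain ⟨k, hk⟩ := h2
  rw [hN, hk]
  simp

/-- no prime power class sizes -/
lemma no_pp {G : Type*} [Group G] [Finite G] [IsSimpleGroup G]
    (hna : ¬ ∀ a b : G, a * b = b * a) (x : G) (hx : x ≠ 1) (t a : ℕ) (ht : t.Prime)
    (h : classSize x ∣ t ^ a) : False := by
  obtain ⟨k, -, hk⟩ := (Nat.dvd_prime_pow ht).mp h
  exact burnside_class hna x hx t ht k hk

lemma ex_of_mem {G : Type*} [Group G] [Finite G] [IsSimpleGroup G]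
    (hna : ¬ ∀ a b : G, a * b = b * a) (v : ℕ) (hv : v ≠ 1) (h : v ∈ sameSizeSet G) :
    ∃ x : G, x ≠ 1 ∧ sameSizeCount G (classSize x) = v ∧ classSize x ∣ v := by
  obtain ⟨x, hx⟩ := h
  refine ⟨x, ?_, hx.symm, hx ▸ classSize_dvd_count x⟩
  rintro rfl
  rw [(classSize_one_iff hna 1).mpr rfl, count_one hna] at hx
  exact hv hx

lemma sylow_ne_one {G : Type*} [Group G] [Finite G] [IsSimpleGroup G]
    (hna : ¬ ∀ a b : G, a * b = b * a) (q : ℕ) [hq : Fact q.Prime] (hqN : q ∣ Nat.card G) :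
    Nat.card (Sylow q G) ≠ 1 := by
  intro h
  let P : Sylow q G := default
  have hP : (P : Subgroup G).Normal := by
    have := (Nat.card_eq_one_iff_unique.mp h).1
    exact P.normal_of_subsingleton
  rcases hP.eq_bot_or_eq_top with h | h
  · exact P.ne_bot_of_dvd_card hqN h
  · have h1 : IsPGroup q G := by
      have := P.2
      intro g
      obtain ⟨k, hk⟩ := this ⟨g, by rw [h]; trivial⟩
      exact ⟨k, by simpa [Subtype.ext_iff] using hk⟩
    have h2 := h1.center_nontrivial
    rw [center_bot hna] at h2
    exact not_nontrivial _ h2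

/-- Embedding into the symmetric group on Sylow subgroups. -/
lemma sylow_embed {G : Type*} [Group G] [Finite G] [IsSimpleGroup G]
    (hna : ¬ ∀ a b : G, a * b = b * a) (q : ℕ) [hq : Fact q.Prime] (hqN : q ∣ Nat.card G) :
    Function.Injective (MulAction.toPermHom G (Sylow q G)) := by
  rw [← MonoidHom.ker_eq_bot_iff]
  rcases (inferInstance : (MulAction.toPermHom G (Sylow q G)).ker.Normal).eq_bot_or_eq_top with h | h
  · exact h
  · exfalso
    apply sylow_ne_one hna q hqN
    rw [Nat.card_eq_one_iff_unique]
    refine ⟨⟨fun P Q => ?_⟩, ⟨default⟩⟩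
    obtain ⟨g, hg⟩ := MulAction.exists_smul_eq G P Q
    have : g ∈ (MulAction.toPermHom G (Sylow q G)).ker := by rw [h]; trivial
    rw [MonoidHom.mem_ker] at this
    have h2 := congrArg (fun σ => σ P) this
    simp at h2
    rw [← hg, h2]

/-- a simple group has no Sylow subgroup with normal complement -/
lemma no_compl {G : Type*} [Group G] [Finite G] [IsSimpleGroup G]
    (hna : ¬ ∀ a b : G, a * b = b * a) (q : ℕ) [hq : Fact q.Prime] (hqN : q ∣ Nat.card G)
    (P : Sylow q G) (h : Subgroup.normalizer (P : Set G) ≤ Subgroup.centralizer (P : Set G)) : False := by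
  have h1 := MonoidHom.ker_transferSylow_isComplement' P h
  have h2 := MonoidHom.not_dvd_card_ker_transferSylow P h
  rcases (inferInstance : (MonoidHom.transferSylow P h).ker.Normal).eq_bot_or_eq_top with h3 | h3
  · rw [h3, Subgroup.isComplement'_bot_left] at h1
    have h4 : Subgroup.normalizer (P : Set G) = ⊤ := by
      have : (P : Subgroup G).Normal := by rw [h1]; infer_instance
      exact Subgroup.normalizer_eq_top _
    rw [h4] at h
    apply hna
    intro a b
    have ha : a ∈ (P : Subgroup G) := by rw [h1]; trivial
    exact (Subgroup.mem_centralizer_iff.mp (h (Subgroup.mem_top b)) a ha)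
  · rw [h3] at h2
    apply h2; rw [Subgroup.card_top]; exact hqN

lemma four_dvd {G : Type*} [Group G] [Finite G] [IsSimpleGroup G]
    (hna : ¬ ∀ a b : G, a * b = b * a) (h2 : 2 ∣ Nat.card G) : 4 ∣ Nat.card G := by
  by_contra h4
  have : Fact (Nat.Prime 2) := ⟨Nat.prime_two⟩
  let P : Sylow 2 G := default
  have hf : (Nat.card G).factorization 2 = 1 := by
    apply le_antisymm
    · by_contra h
      push Not at h
      apply h4
      exact (Nat.Prime.pow_dvd_iff_le_factorization Nat.prime_two Nat.card_pos.ne').mpr h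
    · exact (Nat.Prime.dvd_iff_one_le_factorization Nat.prime_two Nat.card_pos.ne').mp h2
  have hc : Nat.card P = 2 := by rw [P.card_eq_multiplicity, hf, pow_one]
  have hcyc : IsCyclic P := isCyclic_of_prime_card hc
  exact no_compl hna 2 h2 P (hcyc.normalizer_le_centralizer ((Nat.minFac_eq_two_iff _).mpr h2))

/-- The case where the Sylow subgroup has prime order. -/
lemma sylow_prime {G : Type*} [Group G] [Finite G] [IsSimpleGroup G]
    (hna : ¬ ∀ a b : G, a * b = b * a) (q : ℕ) [hq : Fact q.Prime] (hqN : q ∣ Nat.card G)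
    (hq2 : ¬ q ^ 2 ∣ Nat.card G) : ∃ (w : G) (e : ℕ), w ≠ 1 ∧ orderOf w = q ∧ e ≠ 1 ∧ e ∣ q - 1 ∧
      classSize w = Nat.card (Sylow q G) * e ∧ ¬ q ∣ classSize w := by
  let P : Sylow q G := default
  have hf : (Nat.card G).factorization q = 1 := by
    apply le_antisymm
    · by_contra h
      push Not at h
      apply hq2
      exact (Nat.Prime.pow_dvd_iff_le_factorization hq.out Nat.card_pos.ne').mpr h
    · exact (Nat.Prime.dvd_iff_one_le_factorization hq.out Nat.card_pos.ne').mp hqN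
  have hc : Nat.card P = q := by rw [P.card_eq_multiplicity, hf, pow_one]
  have hcyc : IsCyclic P := isCyclic_of_prime_card hc
  obtain ⟨w, ho, hPz⟩ : ∃ w : G, orderOf w = q ∧ (P : Subgroup G) = Subgroup.zpowers w := by
    obtain ⟨w, hw⟩ := hcyc.exists_generator
    have hoP : orderOf w = q := by rw [orderOf_eq_card_of_forall_mem_zpowers hw, hc]
    refine ⟨w, by rw [Subgroup.orderOf_coe, hoP], ?_⟩
    ext g
    constructor
    · intro hg
      obtain ⟨k, hk⟩ := Subgroup.mem_zpowers_iff.mp (hw ⟨g, hg⟩)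
      exact Subgroup.mem_zpowers_iff.mpr ⟨k, by simpa [Subtype.ext_iff] using hk⟩
    · intro hg
      exact (Subgroup.zpowers_le.mpr w.2) hg
  have hcent : Subgroup.centralizer {(w : G)} = Subgroup.centralizer (P : Set G) := by
    have : ((P : Subgroup G) : Set G) = (Subgroup.closure {(w:G)} : Set G) := by
      rw [hPz, Subgroup.zpowers_eq_closure]
    change _ = Subgroup.centralizer ((P : Subgroup G) : Set G)
    rw [this, Subgroup.centralizer_closure]
  have hle : Subgroup.centralizer (P : Set G) ≤ Subgroup.normalizer (P : Set G) :=
    Subgroup.centralizer_le_normalizer _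
  have hidx := Subgroup.relIndex_mul_index hle
  refine ⟨w, (Subgroup.centralizer (P : Set G)).relIndex (Subgroup.normalizer (P : Set G)), ?_, ho, ?_, ?_, ?_, ?_⟩
  · intro h
    rw [h, orderOf_one] at ho
    exact hq.out.one_lt.ne ho
  · intro h
    exact no_compl hna q hqN P (Subgroup.relIndex_eq_one.mp h)
  · have key := Subgroup.card_dvd_of_injective _ (QuotientGroup.kerLift_injective (P : Subgroup G).normalizerMonoidHom)
    rw [Subgroup.normalizerMonoidHom_ker, ← Subgroup.index, ← Subgroup.relIndex] at key
    rw [hcyc.card_mulAut, hc, Nat.totient_prime hq.out] at key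
    exact key
  · rw [classSize_eq_index, hcent, ← hidx, mul_comm, Sylow.card_eq_index_normalizer P]
  · rw [classSize_eq_index]
    intro h
    apply P.not_dvd_index
    refine h.trans (Subgroup.index_dvd_of_le ?_)
    rw [hPz, Subgroup.zpowers_le, Subgroup.mem_centralizer_singleton_iff]

/-- finite check, Sylow subgroup of order q -/
def chk1 (d r q : ℕ) : Bool := (List.range 5).all fun b => !decide (1 ≤ b ∧ (16 * b * q + 1) % r = 0) ||
  (List.range 5).all fun i => !decide (1 ≤ i) || (List.range 16).all fun e =>
    !decide (2 ≤ e ∧ (q - 1) % e = 0 ∧ (2 ^ i * r) % e = 0 ∧ (2 ^ i * r / e) % q = 1 ∧ 2 ^ i * r / e ≠ 1) ||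
    decide (r = 3 ∧ q = 5 ∧ d = 3 ∧ (b = 1 ∨ b = 4) ∧ 2 ^ i * r / e = 6)

/-- finite check, q squared divides the order -/
def chk2 (d r q : ℕ) : Bool := (List.range 5).all fun b => !decide (1 ≤ b ∧ (16 * b * q + 1) % r = 0) ||
  (List.range 7).all fun c => !decide (1 ≤ c ∧
    (1 + r * q + 16 * q * b + 4 * q * r * c + 16 * r * d) % (q * q) = 0 ∧
    (1 + r * q + 16 * q * b + 4 * q * r * c + 16 * r * d) % r = 0) ||
    decide ((q = 5 ∧ (1 + r * q + 16 * q * b + 4 * q * r * c + 16 * r * d = 300 ∨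
      1 + r * q + 16 * q * b + 4 * q * r * c + 16 * r * d = 600)) ∨
    (q = 7 ∧ 1 + r * q + 16 * q * b + 4 * q * r * c + 16 * r * d = 980))

/-- outer loop -/
def chk : Bool := (List.range 5).all fun d => (List.range 128).all fun r => (List.range 64).all fun k =>
  !(Nat.beq ((1 + 16 * d * r) % k) 0) || (!decide (1 ≤ d ∧ 3 ≤ r ∧ 1 ≤ k ∧ (1 + 16 * d * r) % k = 0 ∧
    r < (1 + 16 * d * r) / k ∧ (1 + r * ((1 + 16 * d * r) / k)) % 4 = 0) ||
  (chk1 d r ((1 + 16 * d * r) / k) && chk2 d r ((1 + 16 * d * r) / k)))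

lemma chk_true : chk = true := by decide +kernel

lemma fin0 (d : ℕ) (hd : d < 5) (r : ℕ) (hr : r < 128) (k : ℕ) (hk : k < 64)
    (h1 : 1 ≤ d) (h2 : 3 ≤ r) (h3 : 1 ≤ k) (h4 : (1 + 16 * d * r) % k = 0)
    (h5 : r < (1 + 16 * d * r) / k) (h6 : (1 + r * ((1 + 16 * d * r) / k)) % 4 = 0) :
    chk1 d r ((1 + 16 * d * r) / k) = true ∧ chk2 d r ((1 + 16 * d * r) / k) = true := by
  have h := chk_true
  simp only [chk, List.all_eq_true, List.mem_range, Bool.or_eq_true, Bool.not_eq_true',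
    decide_eq_false_iff_not, Bool.and_eq_true] at h
  exact ((h d hd r hr k hk).resolve_left (by rw [h4]; decide)).resolve_left (not_not.mpr ⟨h1, h2, h3, h4, h5, h6⟩)

lemma fin1 (d r q : ℕ) (h : chk1 d r q = true) : ∀ b < 5, 1 ≤ b →
    (16 * b * q + 1) % r = 0 → ∀ i < 5, 1 ≤ i → ∀ e < 16, 2 ≤ e → (q - 1) % e = 0 →
    (2 ^ i * r) % e = 0 → (2 ^ i * r / e) % q = 1 → 2 ^ i * r / e ≠ 1 →
    r = 3 ∧ q = 5 ∧ d = 3 ∧ (b = 1 ∨ b = 4) ∧ 2 ^ i * r / e = 6 := by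
  intro b hb hb1 hbr i hi hi1 e he he2 a1 a2 a3 a4
  simp only [chk1, List.all_eq_true, List.mem_range, Bool.or_eq_true, Bool.not_eq_true',
    decide_eq_false_iff_not, decide_eq_true_eq] at h
  exact (((h b hb).resolve_left (not_not.mpr ⟨hb1, hbr⟩) i hi).resolve_left (not_not.mpr hi1)
    e he).resolve_left (not_not.mpr ⟨he2, a1, a2, a3, a4⟩)

lemma fin2 (d r q : ℕ) (h : chk2 d r q = true) : ∀ b < 5, 1 ≤ b →
    (16 * b * q + 1) % r = 0 → ∀ c < 7, 1 ≤ c →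
    (1 + r * q + 16 * q * b + 4 * q * r * c + 16 * r * d) % (q * q) = 0 →
    (1 + r * q + 16 * q * b + 4 * q * r * c + 16 * r * d) % r = 0 →
    (q = 5 ∧ (1 + r * q + 16 * q * b + 4 * q * r * c + 16 * r * d = 300 ∨
      1 + r * q + 16 * q * b + 4 * q * r * c + 16 * r * d = 600)) ∨
    (q = 7 ∧ 1 + r * q + 16 * q * b + 4 * q * r * c + 16 * r * d = 980) := by
  intro b hb hb1 hbr c hc hc1 a1 a2
  simp only [chk2, List.all_eq_true, List.mem_range, Bool.or_eq_true, Bool.not_eq_true',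
    decide_eq_false_iff_not, decide_eq_true_eq] at h
  exact ((h b hb).resolve_left (not_not.mpr ⟨hb1, hbr⟩) c hc).resolve_left (not_not.mpr ⟨hc1, a1, a2⟩)

lemma perm_no15 {α : Type*} (h : Nat.card α = 6) (σ : Equiv.Perm α) (ho : orderOf σ = 15) :
    False := by
  classical
  have : Finite α := Nat.finite_of_card_ne_zero (by omega)
  have := Fintype.ofFinite α
  rw [Nat.card_eq_fintype_card] at h
  have h1 := σ.lcm_cycleType
  rw [ho] at h1
  have h2 : σ.cycleType.sum ≤ 6 := by
    rw [Equiv.Perm.sum_cycleType, ← h]; exact Finset.card_le_univ _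
  have h3 : ∀ n ∈ σ.cycleType, n = 3 ∨ n = 5 := by
    intro n hn
    have a1 := Equiv.Perm.two_le_of_mem_cycleType hn
    have a2 := Equiv.Perm.dvd_of_mem_cycleType hn
    have a3 := (Multiset.le_sum_of_mem hn).trans h2
    rw [ho] at a2
    interval_cases n <;> omega
  have h5 : 5 ∈ σ.cycleType := by
    by_contra hh
    have : σ.cycleType.lcm ∣ 3 := Multiset.lcm_dvd.mpr fun n hn => by
      rcases h3 n hn with rfl | rfl
      · exact dvd_rfl
      · exact absurd hn hh
    rw [h1] at this; omega
  have h4 : 3 ∈ σ.cycleType := by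
    by_contra hh
    have : σ.cycleType.lcm ∣ 5 := Multiset.lcm_dvd.mpr fun n hn => by
      rcases h3 n hn with rfl | rfl
      · exact absurd hn hh
      · exact dvd_rfl
    rw [h1] at this; omega
  obtain ⟨t, ht⟩ := Multiset.exists_cons_of_mem h5
  rw [ht] at h4 h2
  rw [Multiset.mem_cons] at h4
  have h6 := Multiset.le_sum_of_mem (h4.resolve_left (by norm_num))
  rw [Multiset.sum_cons] at h2
  omega

/-- divisors of 16 q that are not prime powers -/
lemma dvd16 {G : Type*} [Group G] [Finite G] [IsSimpleGroup G]
    (hna : ¬ ∀ a b : G, a * b = b * a) (x : G) (hx : x ≠ 1) (q : ℕ) (hq : q.Prime)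
    (h : classSize x ∣ 16 * q) : ∃ i, 1 ≤ i ∧ i < 5 ∧ classSize x = 2 ^ i * q := by
  obtain ⟨a, b, ha, hb, hab⟩ := (Nat.dvd_mul).mp h
  obtain ⟨i, hi, rfl⟩ := (Nat.dvd_prime_pow Nat.prime_two (m := 4)).mp ha
  rcases (Nat.dvd_prime hq).mp hb with rfl | rfl
  · exact (no_pp hna x hx 2 i Nat.prime_two (by rw [← hab, mul_one])).elim
  · refine ⟨i, ?_, by omega, hab.symm⟩
    by_contra h0
    have : i = 0 := by omega
    subst this
    exact no_pp hna x hx b 1 hq (by rw [← hab]; simp)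

lemma dvdqr {G : Type*} [Group G] [Finite G] [IsSimpleGroup G]
    (hna : ¬ ∀ a b : G, a * b = b * a) (x : G) (hx : x ≠ 1) (q r : ℕ) (hq : q.Prime) (hr : r.Prime)
    (h : classSize x ∣ r * q) : classSize x = r * q := by
  obtain ⟨a, b, ha, hb, hab⟩ := (Nat.dvd_mul).mp h
  rcases (Nat.dvd_prime hq).mp hb with rfl | rfl
  · exact (no_pp hna x hx r 1 hr (by rw [← hab]; simpa using ha)).elim
  rcases (Nat.dvd_prime hr).mp ha with rfl | rfl
  · exact (no_pp hna x hx b 1 hq (by rw [← hab]; simp)).elim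
  exact hab.symm

lemma dvd4qr {G : Type*} [Group G] [Finite G] [IsSimpleGroup G]
    (hna : ¬ ∀ a b : G, a * b = b * a) (x : G) (hx : x ≠ 1) (q r : ℕ) (hq : q.Prime) (hr : r.Prime)
    (h : classSize x ∣ 4 * q * r) (hne : classSize x ≠ r * q) :
    classSize x ∈ ({2 * q, 4 * q, 2 * r, 4 * r, 2 * q * r, 4 * q * r} : Finset ℕ) := by
  obtain ⟨a', c, ha', hc, hac⟩ := (Nat.dvd_mul).mp h
  obtain ⟨a, b, ha, hb, rfl⟩ := (Nat.dvd_mul).mp ha'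
  obtain ⟨i, hi, rfl⟩ := (Nat.dvd_prime_pow Nat.prime_two (m := 2)).mp ha
  rw [← hac] at hne ⊢
  simp only [Finset.mem_insert, Finset.mem_singleton]
  rcases (Nat.dvd_prime hq).mp hb with rfl | rfl <;> rcases (Nat.dvd_prime hr).mp hc with rfl | rfl
  · exact (no_pp hna x hx 2 i Nat.prime_two (by rw [← hac]; simp)).elim
  · interval_cases i
    · exact (no_pp hna x hx c 1 hr (by rw [← hac]; simp)).elim
    · simp
    · simp
  · interval_cases i
    · exact (no_pp hna x hx b 1 hq (by rw [← hac]; simp)).elim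
    · simp
    · simp
  · interval_cases i
    · exact absurd (by ring) hne
    · simp
    · simp

lemma struct_p2 {G : Type*} [Group G] [Finite G] [IsSimpleGroup G]
    (hna : ¬ ∀ a b : G, a * b = b * a) (q r : ℕ) (hq : q.Prime) (hr : r.Prime)
    (hq2 : q ≠ 2) (hr2 : r ≠ 2) (hqr : q ≠ r)
    (hU : sameSizeSet G = {1, r * q, 16 * q, 4 * q * r, 16 * r}) :
    ∃ b c d : ℕ, 1 ≤ b ∧ b < 5 ∧ 1 ≤ c ∧ c < 7 ∧ 1 ≤ d ∧ d < 5 ∧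
      Nat.card G = 1 + r * q + 16 * q * b + 4 * q * r * c + 16 * r * d ∧
      q ∣ Nat.card G ∧ r ∣ Nat.card G ∧ 2 ∣ Nat.card G ∧
      ∀ x : G, x ≠ 1 → ¬ q ∣ classSize x → ∃ i, 1 ≤ i ∧ i < 5 ∧ classSize x = 2 ^ i * r := by
  classical
  have hq3 : 3 ≤ q := by have := hq.two_le; omega
  have hr3 : 3 ≤ r := by have := hr.two_le; omega
  have hqo : q % 2 = 1 := (hq.eq_two_or_odd).resolve_left hq2
  have hro : r % 2 = 1 := (hr.eq_two_or_odd).resolve_left hr2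
  have hrqo : (r * q) % 2 = 1 := by rw [Nat.mul_mod, hqo, hro]
  have hrq9 : 9 ≤ r * q := by nlinarith
  have e4 : 4 * q * r = 4 * (r * q) := by ring
  obtain ⟨S, hS, hN⟩ := card_eq_sum (G := G)
  have hmem : ∀ x : G, sameSizeCount G (classSize x) ∈ sameSizeSet G := fun x => ⟨x, rfl⟩
  obtain ⟨xa, hxa, hua, hda⟩ := ex_of_mem (G := G) hna (r * q) (by omega) (by rw [hU]; simp)
  obtain ⟨xb, hxb, hub, hdb⟩ := ex_of_mem (G := G) hna (16 * q) (by omega) (by rw [hU]; simp)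
  obtain ⟨xc, hxc, huc, hdc⟩ := ex_of_mem (G := G) hna (4 * q * r) (by omega) (by rw [hU]; simp)
  obtain ⟨xd, hxd, hud, hdd⟩ := ex_of_mem (G := G) hna (16 * r) (by omega) (by rw [hU]; simp)
  have hna' := dvdqr hna xa hxa q r hq hr hda
  have hNa : r * q ∣ Nat.card G := hna' ▸ classSize_dvd_card xa
  have frq : sameSizeCount G (r * q) = r * q := by rw [hna'] at hua; exact hua
  have hx1 : ∀ x : G, ∀ v, v ≠ 1 → sameSizeCount G (classSize x) = v → x ≠ 1 := by
    rintro x v hv hx rfl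
    rw [(classSize_one_iff hna 1).mpr rfl, count_one hna] at hx
    exact hv hx.symm
  have n1 : r * q ≠ 16 * q := by omega
  have n2 : r * q ≠ 16 * r := by omega
  have n3 : 16 * q ≠ 4 * q * r := by
    intro h
    have : q * 4 = q * r := by linarith
    have := Nat.eq_of_mul_eq_mul_left (by omega) this
    omega
  have n4 : 16 * r ≠ 4 * q * r := by
    intro h
    have : r * 4 = r * q := by linarith
    have := Nat.eq_of_mul_eq_mul_left (by omega) this
    omega
  have fib := Finset.sum_fiberwise_of_maps_to (s := S) (t := {1, r * q, 16 * q, 4 * q * r, 16 * r})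
    (g := sameSizeCount G) (f := sameSizeCount G) (by
      intro n hn
      obtain ⟨x, rfl⟩ := (hS n).mp hn
      have := hmem x
      rw [hU] at this
      simpa using this)
  have fc : ∀ v, (∑ n ∈ S with sameSizeCount G n = v, sameSizeCount G n)
      = (S.filter (fun n => sameSizeCount G n = v)).card * v := by
    intro v
    rw [Finset.sum_congr rfl (fun n hn => (Finset.mem_filter.mp hn).2), Finset.sum_const, smul_eq_mul]
  simp only [fc] at fib
  rw [Finset.sum_insert (by simp; omega), Finset.sum_insert (by simp; omega),
    Finset.sum_insert (by simp; omega), Finset.sum_insert (by simp; omega),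
    Finset.sum_singleton, ← hN] at fib
  have c1 : (S.filter (fun n => sameSizeCount G n = 1)).card = 1 := by
    rw [Finset.card_eq_one]
    refine ⟨1, ?_⟩
    ext n
    simp only [Finset.mem_filter, Finset.mem_singleton]
    constructor
    · rintro ⟨hn, h1⟩
      obtain ⟨x, rfl⟩ := (hS n).mp hn
      have := classSize_dvd_count x
      rw [h1] at this
      exact Nat.dvd_one.mp this
    · rintro rfl
      exact ⟨(hS 1).mpr ⟨1, (classSize_one_iff hna 1).mpr rfl⟩, count_one hna⟩
  have c2 : (S.filter (fun n => sameSizeCount G n = r * q)).card = 1 := by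
    rw [Finset.card_eq_one]
    refine ⟨r * q, ?_⟩
    ext n
    simp only [Finset.mem_filter, Finset.mem_singleton]
    constructor
    · rintro ⟨hn, h1⟩
      obtain ⟨x, rfl⟩ := (hS n).mp hn
      have := classSize_dvd_count x
      rw [h1] at this
      exact dvdqr hna x (hx1 x _ (by omega) h1) q r hq hr this
    · rintro rfl
      exact ⟨(hS _).mpr ⟨xa, hna'⟩, frq⟩
  have pos : ∀ x : G, 1 ≤ (S.filter (fun n => sameSizeCount G n = sameSizeCount G (classSize x))).card := by
    intro x
    apply Finset.card_pos.mpr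
    exact ⟨classSize x, Finset.mem_filter.mpr ⟨(hS _).mpr ⟨x, rfl⟩, rfl⟩⟩
  have ub : ∀ t : ℕ, t.Prime → 16 * t ≠ 1 →
      (S.filter (fun n => sameSizeCount G n = 16 * t)).card < 5 := by
    intro t ht ht1
    have : S.filter (fun n => sameSizeCount G n = 16 * t) ⊆
        (Finset.Ico 1 5).image (fun i => 2 ^ i * t) := by
      intro n hn
      obtain ⟨hn, h1⟩ := Finset.mem_filter.mp hn
      obtain ⟨x, rfl⟩ := (hS n).mp hn
      have := classSize_dvd_count x
      rw [h1] at this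
      obtain ⟨i, h1, h2, h3⟩ := dvd16 hna x (hx1 x _ ht1 h1) t ht this
      exact Finset.mem_image.mpr ⟨i, by simp; omega, h3.symm⟩
    have h2 := (Finset.card_le_card this).trans Finset.card_image_le
    simp at h2
    omega
  have uc : (S.filter (fun n => sameSizeCount G n = 4 * q * r)).card < 7 := by
    have : S.filter (fun n => sameSizeCount G n = 4 * q * r) ⊆
        {2 * q, 4 * q, 2 * r, 4 * r, 2 * q * r, 4 * q * r} := by
      intro n hn
      obtain ⟨hn, h1⟩ := Finset.mem_filter.mp hn
      obtain ⟨x, rfl⟩ := (hS n).mp hn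
      have := classSize_dvd_count x
      rw [h1] at this
      refine dvd4qr hna x (hx1 x _ (by omega) h1) q r hq hr this ?_
      intro h
      rw [h, frq] at h1
      omega
    have := (Finset.card_le_card this).trans Finset.card_le_six
    omega
  have pb := pos xb
  have pc := pos xc
  have pd := pos xd
  rw [hub] at pb
  rw [huc] at pc
  rw [hud] at pd
  rw [c1, c2] at fib
  refine ⟨_, _, _, pb, ub q hq (by omega), pc, uc, pd, ub r hr (by omega), by linarith,
    (Dvd.intro_left _ rfl).trans hNa, (Dvd.intro _ rfl).trans hNa, ?_, ?_⟩
  · obtain ⟨i, h1, -, h3⟩ := dvd16 hna xb hxb q hq hdb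
    refine dvd_trans ?_ (h3 ▸ classSize_dvd_card xb)
    exact (dvd_pow_self 2 (by omega)).mul_right q
  · intro x hx hqx
    have hm := hmem x
    have hd := classSize_dvd_count x
    rw [hU] at hm
    simp only [Set.mem_insert_iff, Set.mem_singleton_iff] at hm
    rcases hm with h | h | h | h | h <;> rw [h] at hd
    · exact absurd ((classSize_one_iff hna x).mp (Nat.dvd_one.mp hd)) hx
    · exact absurd (by rw [dvdqr hna x hx q r hq hr hd]; exact Dvd.intro_left _ rfl) hqx
    · obtain ⟨i, -, -, h3⟩ := dvd16 hna x hx q hq hd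
      exact absurd (by rw [h3]; exact Dvd.intro_left _ rfl) hqx
    · have h5 := dvd4qr hna x hx q r hq hr hd (by
        intro h6; exact hqx (by rw [h6]; exact Dvd.intro_left _ rfl))
      simp only [Finset.mem_insert, Finset.mem_singleton] at h5
      rcases h5 with h | h | h | h | h | h
      · exact absurd (by rw [h]; exact Dvd.intro_left _ rfl) hqx
      · exact absurd (by rw [h]; exact Dvd.intro_left _ rfl) hqx
      · exact ⟨1, by norm_num, by norm_num, by rw [h]; ring⟩
      · exact ⟨2, by norm_num, by norm_num, by rw [h]; ring⟩
      · exact absurd (by rw [h]; exact (Dvd.intro_left _ rfl).mul_right _) hqx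
      · exact absurd (by rw [h]; exact (Dvd.intro_left _ rfl).mul_right _) hqx
    · exact dvd16 hna x hx r hr hd

lemma card_dvd_720 {G : Type*} [Group G] [Finite G] [IsSimpleGroup G]
    (hna : ¬ ∀ a b : G, a * b = b * a) (q : ℕ) [hq : Fact q.Prime] (hqN : q ∣ Nat.card G)
    (h6 : Nat.card (Sylow q G) = 6) : Nat.card G ∣ 720 := by
  have h := Subgroup.card_dvd_of_injective _ (sylow_embed hna q hqN)
  rw [Nat.card_perm, h6] at h
  exact h

lemma case_p2 {G : Type*} [Group G] [Finite G] [IsSimpleGroup G]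
    (hna : ¬ ∀ a b : G, a * b = b * a) (q r : ℕ) (hq : q.Prime) (hr : r.Prime)
    (hq2 : q ≠ 2) (hr2 : r ≠ 2) (hqr : r < q)
    (hU : sameSizeSet G = {1, r * q, 16 * q, 4 * q * r, 16 * r}) : False := by
  obtain ⟨b, c, d, hb1, hb5, hc1, hc7, hd1, hd5, hN, hqN, hrN, h2N, hcl⟩ :=
    struct_p2 hna q r hq hr hq2 hr2 hqr.ne' hU
  have hr3 : 3 ≤ r := by have := hr.two_le; omega
  have hqf : Fact q.Prime := ⟨hq⟩
  have h4 := four_dvd hna h2N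
  have hm4 : (1 + r * q) % 4 = 0 := by
    have e4 : 4 * q * r * c = 4 * (q * r * c) := by ring
    have e5 : 16 * q * b = 4 * (4 * q * b) := by ring
    have e6 : 16 * r * d = 4 * (4 * r * d) := by ring
    rw [hN, e4, e5, e6] at h4
    omega
  have hqd : q ∣ 1 + 16 * d * r := by
    have : Nat.card G = (1 + 16 * d * r) + q * (r + 16 * b + 4 * r * c) := by rw [hN]; ring
    rw [this] at hqN
    exact (Nat.dvd_add_left (Dvd.intro _ rfl)).mp hqN
  have hrd : r ∣ 16 * b * q + 1 := by
    have : Nat.card G = (16 * b * q + 1) + r * (q + 16 * d + 4 * q * c) := by rw [hN]; ring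
    rw [this] at hrN
    exact (Nat.dvd_add_left (Dvd.intro _ rfl)).mp hrN
  obtain ⟨k, hk⟩ := hqd
  have hk1 : 1 ≤ k := by
    rcases Nat.eq_zero_or_pos k with rfl | h
    · simp at hk
    · exact h
  have hk64 : k < 64 := by
    by_contra h
    have : 64 * q ≤ q * k := by nlinarith
    have : 16 * d * r ≤ 64 * r := by nlinarith
    omega
  have hr128 : r < 128 := by
    have h1 : r ∣ q * (16 * b + k) := by
      have : q * (16 * b + k) = (16 * b * q + 1) + r * (16 * d) := by
        rw [mul_add, ← hk]; ring
      rw [this]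
      exact dvd_add hrd (Dvd.intro _ rfl)
    have h2 : r ∣ 16 * b + k := by
      rcases hr.dvd_mul.mp h1 with h | h
      · exact absurd ((Nat.prime_dvd_prime_iff_eq hr hq).mp h) hqr.ne
      · exact h
    have := Nat.le_of_dvd (by omega) h2
    omega
  have hkm : (1 + 16 * d * r) % k = 0 := by rw [hk]; simp
  have hqe : (1 + 16 * d * r) / k = q := by
    rw [hk, Nat.mul_div_cancel _ hk1]
  have I0 := fin0 d hd5 r hr128 k hk64 hd1 hr3 hk1 hkm
  rw [hqe] at I0
  have I1 := fin1 d r q (I0 hqr hm4).1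
  have I2 := fin2 d r q (I0 hqr hm4).2
  have hn1 := sylow_ne_one hna q hqN
  have hnmod : Nat.card (Sylow q G) % q = 1 := by
    have := card_sylow_modEq_one q G
    rw [Nat.ModEq, Nat.mod_eq_of_lt hq.one_lt] at this
    exact this
  by_cases hqq : q ^ 2 ∣ Nat.card G
  · have hF := I2 b hb5 hb1
      (Nat.mod_eq_zero_of_dvd hrd) c hc7 hc1 (by
        rw [← hN, ← pow_two]; exact Nat.mod_eq_zero_of_dvd hqq) (by rw [← hN]; exact Nat.mod_eq_zero_of_dvd hrN)
    rw [← hN] at hF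
    let P : Sylow q G := default
    have i1 := P.card_dvd_index
    have i2 := P.pow_dvd_card_of_pow_dvd_card hqq
    have i3 := (P : Subgroup G).card_mul_index
    have i4 : q ^ 2 * Nat.card (Sylow q G) ∣ Nat.card G := by
      rw [← i3]; exact mul_dvd_mul i2 i1
    have i5 : Nat.card (Sylow q G) ∣ Nat.card G / q ^ 2 := by
      obtain ⟨m, hm⟩ := i4
      rw [hm, mul_assoc, Nat.mul_div_cancel_left _ (pow_pos hq.pos 2)]
      exact Dvd.intro _ rfl
    rcases hF with ⟨rfl, h | h⟩ | ⟨rfl, h⟩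
    · have : Nat.card (Sylow 5 G) = 6 := by
        rw [h] at i5
        have := Nat.le_of_dvd (by norm_num) i5
        norm_num at this i5
        generalize Nat.card (Sylow 5 G) = n at *
        interval_cases n <;> omega
      have := card_dvd_720 hna 5 hqN this
      rw [h] at this
      omega
    · have : Nat.card (Sylow 5 G) = 6 := by
        rw [h] at i5
        have := Nat.le_of_dvd (by norm_num) i5
        norm_num at this i5
        generalize Nat.card (Sylow 5 G) = n at *
        interval_cases n <;> omega
      have := card_dvd_720 hna 5 hqN this
      rw [h] at this
      omega
    · rw [h] at i5
      have := Nat.le_of_dvd (by norm_num) i5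
      norm_num at this i5
      generalize Nat.card (Sylow 7 G) = n at *
      interval_cases n <;> omega
  · obtain ⟨w, e, hw1, how, he1, heq, hcw, hqw⟩ := sylow_prime hna q hqN hqq
    obtain ⟨i, hi1, hi5, hi⟩ := hcl w hw1 hqw
    have hpos : 0 < 2 ^ i * r := by positivity
    have he0 : 0 < e := by
      rcases Nat.eq_zero_or_pos e with rfl | h
      · rw [hcw, mul_zero] at hi; omega
      · exact h
    have hdiv : 2 ^ i * r / e = Nat.card (Sylow q G) := by
      rw [← hi, hcw, Nat.mul_div_cancel _ he0]
    have hnq : q < Nat.card (Sylow q G) := by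
      by_contra h
      rcases (not_lt.mp h).lt_or_eq with h | h
      · rw [Nat.mod_eq_of_lt h] at hnmod; exact hn1 hnmod
      · rw [h, Nat.mod_self] at hnmod; omega
    have he16 : e < 16 := by
      by_contra h
      have h1 : 2 ^ i * r ≤ 16 * r := by
        apply Nat.mul_le_mul_right
        calc 2 ^ i ≤ 2 ^ 4 := Nat.pow_le_pow_right (by norm_num) (by omega)
          _ = 16 := by norm_num
      have h2 : q * 16 ≤ Nat.card (Sylow q G) * e := by
        apply Nat.mul_le_mul hnq.le; omega
      rw [← hcw, hi] at h2
      omega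
    obtain ⟨hr', hq', hd', hb', hn'⟩ := I1 b hb5 hb1
      (Nat.mod_eq_zero_of_dvd hrd) i hi5 hi1 e he16 (by omega) (Nat.mod_eq_zero_of_dvd heq)
      (Nat.mod_eq_zero_of_dvd (by rw [← hi, hcw]; exact Dvd.intro_left _ rfl))
      (by rw [hdiv]; exact hnmod) (by rw [hdiv]; exact hn1)
    rw [hdiv] at hn'
    have h720 := card_dvd_720 hna q hqN hn'
    subst hr' hq' hd'
    have h9 : 9 ∣ Nat.card G := by
      rcases hb' with rfl | rfl <;> interval_cases c <;> rw [hN] at h720 hqq ⊢ <;> omega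
    have hci := (Subgroup.centralizer {w}).card_mul_index
    rw [← classSize_eq_index, hi] at hci
    have h3c : 3 ∣ Nat.card (Subgroup.centralizer {w}) := by
      rw [← hci] at h9
      have : 3 ∣ Nat.card (Subgroup.centralizer {w}) * 2 ^ i := by
        apply Nat.dvd_of_mul_dvd_mul_left (by norm_num : 0 < 3)
        refine (show 3 * 3 ∣ _ from h9).trans (dvd_of_eq (by ring))
      refine Nat.Coprime.dvd_of_dvd_mul_right ?_ this
      exact Nat.Coprime.pow_right _ (by norm_num)
    have : Fact (Nat.Prime 3) := ⟨Nat.prime_three⟩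
    obtain ⟨y, hy⟩ := exists_prime_orderOf_dvd_card' 3 h3c
    have hcomm : Commute w (y : G) := by
      have := Subgroup.mem_centralizer_singleton_iff.mp y.2
      first | exact this | exact this.symm
    have hy' : orderOf (y : G) = 3 := by rw [Subgroup.orderOf_coe, hy]
    have ho15 : orderOf (w * y) = 15 := by
      rw [hcomm.orderOf_mul_eq_mul_orderOf_of_coprime (by rw [how, hy']; norm_num), how, hy']
    refine perm_no15 hn' (MulAction.toPermHom G (Sylow 5 G) (w * y)) ?_
    rw [orderOf_injective _ (sylow_embed hna 5 hqN), ho15]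

theorem stmt_18 (p q r : ℕ) (hp : p.Prime) (hq : q.Prime) (hr : r.Prime)
    (G : Type*) [Group G] [Finite G] [IsSimpleGroup G]
    (hna : ¬ ∀ a b : G, a * b = b * a)
    (hU : sameSizeSet G = {1, r * q, 8 * p * q, 4 * q * r, 8 * p * r}) :
    Odd p ∧ Odd q ∧ Odd r ∧ p ≠ q ∧ q ≠ r ∧ p ≠ r := by
  have hmem : ∀ x : G, sameSizeCount G (classSize x) = 1 ∨ sameSizeCount G (classSize x) = r * q ∨
      sameSizeCount G (classSize x) = 8 * p * q ∨ sameSizeCount G (classSize x) = 4 * q * r ∨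
      sameSizeCount G (classSize x) = 8 * p * r := by
    intro x
    have : sameSizeCount G (classSize x) ∈ sameSizeSet G := ⟨x, rfl⟩
    rw [hU] at this
    simpa using this
  have hp2 := hp.two_le
  have hq2 := hq.two_le
  have hr2 := hr.two_le
  have b1 : r * q ≠ 1 := by nlinarith
  have b2 : 8 * p * q ≠ 1 := by nlinarith
  have b3 : 8 * p * r ≠ 1 := by nlinarith
  obtain ⟨xa, hxa, -, hda⟩ := ex_of_mem (G := G) hna (r * q) b1 (by rw [hU]; simp)
  obtain ⟨xb, hxb, -, hdb⟩ := ex_of_mem (G := G) hna (8 * p * q) b2 (by rw [hU]; simp)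
  obtain ⟨xd, hxd, -, hdd⟩ := ex_of_mem (G := G) hna (8 * p * r) b3 (by rw [hU]; simp)
  have cop : ∀ t : ℕ, t ∣ r * q → t ∣ 8 * p * q → t ∣ 4 * q * r → t ∣ 8 * p * r →
      ∀ x : G, (classSize x).Coprime t := by
    intro t h1 h2 h3 h4 x
    have := coprime_of_dvd hna t (fun x => by
      rcases hmem x with h | h | h | h | h
      · exact Or.inl h
      all_goals right; rw [h]; assumption)
    exact (Nat.Coprime.coprime_dvd_right (classSize_dvd_card x) this).symm
  have hqr : q ≠ r := by
    rintro rfl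
    exact no_pp hna xa hxa q 2 hq (by rw [pow_two]; exact hda)
  have hpq : p ≠ q := by
    rintro rfl
    have c := cop p (Dvd.intro_left _ rfl) (Dvd.intro_left _ rfl) ((Dvd.intro_left _ rfl).mul_right _)
      ((Dvd.intro_left _ rfl).mul_right _) xb
    exact no_pp hna xb hxb 2 3 Nat.prime_two
      (c.dvd_of_dvd_mul_right (c.dvd_of_dvd_mul_right hdb))
  have hpr : p ≠ r := by
    rintro rfl
    have c := cop p (Dvd.intro _ rfl) ((Dvd.intro_left _ rfl).mul_right _) (Dvd.intro_left _ rfl)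
      ((Dvd.intro_left _ rfl).mul_right _) xd
    exact no_pp hna xd hxd 2 3 Nat.prime_two
      (c.dvd_of_dvd_mul_right (c.dvd_of_dvd_mul_right hdd))
  have hq2' : q ≠ 2 := by
    rintro rfl
    have c := cop 2 (by omega) (by omega) (by omega) ⟨4 * p * r, by ring⟩ xa
    exact no_pp hna xa hxa r 1 hr (by rw [pow_one]; exact c.dvd_of_dvd_mul_right hda)
  have hr2' : r ≠ 2 := by
    rintro rfl
    have c := cop 2 (by omega) ⟨4 * p * q, by ring⟩ (by omega) (by omega) xa
    exact no_pp hna xa hxa q 1 hq (by rw [pow_one]; exact c.dvd_of_dvd_mul_left hda)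
  have hp2' : p ≠ 2 := by
    rintro rfl
    norm_num at hU
    rcases lt_or_gt_of_ne hqr with h | h
    · refine case_p2 hna r q hr hq hr2' hq2' h ?_
      rw [hU]
      ext v
      simp only [Set.mem_insert_iff, Set.mem_singleton_iff]
      rw [mul_comm q r, show 4 * r * q = 4 * q * r by ring]
      tauto
    · exact case_p2 hna q r hq hr hq2' hr2' h hU
  exact ⟨hp.odd_of_ne_two hp2', hq.odd_of_ne_two hq2', hr.odd_of_ne_two hr2', hpq, hqr, hpr⟩
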